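/- Let the physical parameters E_F, e, ε₀, c₀, Γ, h, f, v_F, τ, k₀, k_u, k_w, d be positive and X₀ ≠ 0 real. Then there exist c > 0 and N ∈ ℕ such that |Δ^TE_p| ≥ c⟨p⟩² for all p with |p| ≥ N. Consequently, if in addition inf_{p∈ℤ} |Δ^TE_p| > 0, there is a constant C > 0 with 1/|Δ^TE_p| ≤ C⟨p⟩^{−2} for all p ∈ ℤ. -/

import Mathlib

open Real Complex

/-- The vertical wavenumber. -/
noncomputable def gamC (k a : ℝ) : ℂ :=
  if a ^ 2 ≤ k ^ 2 then ((Real.sqrt (k ^ 2 - a ^ 2) : ℝ) : ℂ)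
  else Complex.I * ((Real.sqrt (a ^ 2 - k ^ 2) : ℝ) : ℂ)

/-- The transverse-electric determinant. -/
noncomputable def DeltaTE (d α ku kw k₀ X₀ : ℝ) (σl σn : ℂ) (p : ℤ) : ℂ :=
  -Complex.I * gamC ku (α + (2 * π / d) * p)
    - Complex.I * gamC kw (α + (2 * π / d) * p)
    - Complex.I * (k₀ : ℂ) * σl * (X₀ : ℂ)
    - Complex.I * (k₀ : ℂ) * σn * (X₀ : ℂ) * ((((α + (2 * π / d) * p) ^ 2 : ℝ)) : ℂ)

lemma norm_gamC_le (k a : ℝ) : ‖gamC k a‖ ≤ |a| + |k| := by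
  unfold gamC
  split_ifs
  · rw [Complex.norm_real, Real.norm_eq_abs, abs_of_nonneg (Real.sqrt_nonneg _)]
    apply Real.sqrt_le_iff.mpr
    constructor
    · positivity
    · nlinarith [sq_abs a, sq_abs k, abs_nonneg a, abs_nonneg k,
        mul_nonneg (abs_nonneg a) (abs_nonneg k)]
  · rw [norm_mul, Complex.norm_I, one_mul, Complex.norm_real, Real.norm_eq_abs,
      abs_of_nonneg (Real.sqrt_nonneg _)]
    apply Real.sqrt_le_iff.mpr
    constructor
    · positivity
    · nlinarith [sq_abs a, sq_abs k, abs_nonneg a, abs_nonneg k,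
        mul_nonneg (abs_nonneg a) (abs_nonneg k)]

lemma le_norm_DeltaTE (d α ku kw k₀ X₀ : ℝ) (σl σn : ℂ) (p : ℤ) :
    ‖(k₀ : ℂ) * σn * (X₀ : ℂ)‖ * (α + (2 * π / d) * p) ^ 2 - 2 * |α + (2 * π / d) * p|
      - (|ku| + |kw| + ‖(k₀ : ℂ) * σl * (X₀ : ℂ)‖) ≤ ‖DeltaTE d α ku kw k₀ X₀ σl σn p‖ := by
  set a : ℝ := α + (2 * π / d) * p with ha
  have hΔ : DeltaTE d α ku kw k₀ X₀ σl σn p = -Complex.I *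
      (((k₀ : ℂ) * σn * X₀ * ((a ^ 2 : ℝ) : ℂ))
        + (gamC ku a + gamC kw a + (k₀ : ℂ) * σl * X₀)) := by
    rw [DeltaTE, ← ha]
    ring
  have hmain : ‖(k₀ : ℂ) * σn * X₀ * ((a ^ 2 : ℝ) : ℂ)‖ = ‖(k₀ : ℂ) * σn * X₀‖ * a ^ 2 := by
    rw [norm_mul _ ((a ^ 2 : ℝ) : ℂ), Complex.norm_real, Real.norm_eq_abs,
      abs_of_nonneg (sq_nonneg a)]
  rw [hΔ, norm_mul (-Complex.I), norm_neg, Complex.norm_I, one_mul]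
  have hsub := norm_sub_le_norm_add ((k₀ : ℂ) * σn * X₀ * ((a ^ 2 : ℝ) : ℂ))
    (gamC ku a + gamC kw a + (k₀ : ℂ) * σl * X₀)
  have htri := norm_add₃_le (a := gamC ku a) (b := gamC kw a) (c := (k₀ : ℂ) * σl * X₀)
  linarith [norm_gamC_le ku a, norm_gamC_le kw a]

/-- A quadratic with positive leading coefficient, evaluated along an arithmetic progression,
dominates a multiple of `1 + p ^ 2`. -/
lemma exists_mul_one_add_sq_le {B β : ℝ} (hB : 0 < B) (hβ : β ≠ 0) (α K : ℝ) :
    ∃ c : ℝ, 0 < c ∧ ∃ N : ℕ, ∀ p : ℤ, (N : ℤ) ≤ |p| →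
      c * (1 + |(p : ℝ)| ^ 2) ≤ B * (α + β * p) ^ 2 - 2 * |α + β * p| - K := by
  have hc : 0 < B * β ^ 2 / 8 := by positivity
  set c := B * β ^ 2 / 8 with hcdef
  set M := B / 2 * α ^ 2 + 2 / B + K with hM
  obtain ⟨n, hn⟩ := exists_nat_ge ((M + c) / c)
  refine ⟨c, hc, n + 1, fun p hp => ?_⟩
  have hp' : (n : ℝ) + 1 ≤ |(p : ℝ)| := by exact_mod_cast hp
  have hMc : M + c ≤ c * |(p : ℝ)| ^ 2 := by
    rw [div_le_iff₀ hc] at hn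
    have : (n : ℝ) ≤ |(p : ℝ)| ^ 2 := by nlinarith [(Nat.cast_nonneg n : (0 : ℝ) ≤ n)]
    nlinarith
  have hlin : 2 * |α + β * p| ≤ B / 2 * (α + β * p) ^ 2 + 2 / B := by
    have hsq : B / 2 * (α + β * p) ^ 2 + 2 / B - 2 * |α + β * p|
        = B / 2 * (|α + β * p| - 2 / B) ^ 2 := by
      rw [sub_sq, sq_abs]
      field_simp
      ring
    have : 0 ≤ B / 2 * (|α + β * p| - 2 / B) ^ 2 := by positivity
    linarith
  have hquad : B / 2 * (β ^ 2 * (p : ℝ) ^ 2 / 2 - α ^ 2) ≤ B / 2 * (α + β * p) ^ 2 := by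
    gcongr
    nlinarith [sq_nonneg (2 * α + β * p)]
  have hexp : B / 2 * (β ^ 2 * (p : ℝ) ^ 2 / 2 - α ^ 2)
      = 2 * (c * |(p : ℝ)| ^ 2) - B / 2 * α ^ 2 := by
    rw [sq_abs, hcdef]
    ring
  linarith

/-- An eventual quadratic lower bound together with a uniform positive one gives a global
quadratic bound on the inverse. -/
lemma exists_one_div_le_div_one_add_sq {F : ℤ → ℝ} {c μ : ℝ} {N : ℕ} (hc : 0 < c) (hμ : 0 < μ)
    (hF : ∀ p : ℤ, (N : ℤ) ≤ |p| → c * (1 + |(p : ℝ)| ^ 2) ≤ F p) (hFμ : ∀ p, μ ≤ F p) :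
    ∃ C : ℝ, 0 < C ∧ ∀ p : ℤ, 1 / F p ≤ C / (1 + |(p : ℝ)| ^ 2) := by
  refine ⟨max (1 / c) ((1 + (N : ℝ) ^ 2) / μ), by positivity, fun p => ?_⟩
  have hFp : 0 < F p := hμ.trans_le (hFμ p)
  rw [div_le_div_iff₀ hFp (by positivity), one_mul]
  rcases le_or_gt (N : ℤ) |p| with hp | hp
  · calc 1 + |(p : ℝ)| ^ 2 ≤ 1 / c * F p := by
          rw [one_div, inv_mul_eq_div, le_div_iff₀ hc, mul_comm]
          exact hF p hp
      _ ≤ _ := by gcongr; exact le_max_left _ _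
  · have hp' : |(p : ℝ)| ≤ N := by exact_mod_cast hp.le
    calc 1 + |(p : ℝ)| ^ 2 ≤ 1 + (N : ℝ) ^ 2 := by gcongr
      _ = (1 + (N : ℝ) ^ 2) / μ * μ := by field_simp
      _ ≤ (1 + (N : ℝ) ^ 2) / μ * F p := by gcongr; exact hFμ p
      _ ≤ _ := by gcongr; exact le_max_right _ _

lemma ofReal_add_I_mul_ne_zero {x : ℝ} (hx : x ≠ 0) (y : ℝ) : (x : ℂ) + Complex.I * y ≠ 0 := by
  intro h
  apply hx
  simpa using congrArg Complex.re h

/-- with the physical BGK conductivities and `X₀ ≠ 0`, the TE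
determinant grows quadratically: `|Δ^TE_p| ≥ c⟨p⟩²` for all large `|p|`;
consequently, if moreover `inf_p |Δ^TE_p| > 0`, then `1/|Δ^TE_p| ≤ C⟨p⟩^{−2}`
for all `p`. -/
theorem DeltaTE_growth (d α ku kw k₀ X₀ : ℝ)
    (hd : 0 < d) (hku : 0 < ku) (hkw : 0 < kw) (hk₀ : 0 < k₀) (hX₀ : X₀ ≠ 0)
    (EF e ε₀ c₀ Γ h f vF τ : ℝ)
    (hEF : 0 < EF) (he : 0 < e) (hε₀ : 0 < ε₀) (hc₀ : 0 < c₀)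
    (hΓ : 0 < Γ) (hh : 0 < h) (hf : 0 < f) (hvF : 0 < vF) (hτ : 0 < τ)
    (σl σn Q : ℂ)
    (hσl : σl = ((2 * EF * e ^ 2 / (ε₀ * c₀) : ℝ) : ℂ) /
      ((Γ : ℂ) - Complex.I * (h : ℂ) * (f : ℂ)))
    (hQ : Q = ((vF ^ 2 : ℝ) : ℂ) *
      ((3 * (f : ℂ) + 2 * Complex.I / (τ : ℂ)) /
        (4 * (f : ℂ) * ((f : ℂ) + Complex.I / (τ : ℂ)) ^ 2)))
    (hσn : σn = σl * Q) :
    (∃ c : ℝ, 0 < c ∧ ∃ N : ℕ, ∀ p : ℤ, (N : ℤ) ≤ |p| →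
      c * (1 + |(p : ℝ)| ^ 2) ≤ ‖DeltaTE d α ku kw k₀ X₀ σl σn p‖) ∧
    ((∃ μ : ℝ, 0 < μ ∧ ∀ p : ℤ, μ ≤ ‖DeltaTE d α ku kw k₀ X₀ σl σn p‖) →
      ∃ C : ℝ, 0 < C ∧ ∀ p : ℤ,
        1 / ‖DeltaTE d α ku kw k₀ X₀ σl σn p‖ ≤ C / (1 + |(p : ℝ)| ^ 2)) := by
  have hσl0 : σl ≠ 0 := by
    rw [hσl]
    refine div_ne_zero (Complex.ofReal_ne_zero.mpr (by positivity)) ?_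
    convert ofReal_add_I_mul_ne_zero hΓ.ne' (-(h * f)) using 1
    push_cast
    ring
  have hQ0 : Q ≠ 0 := by
    have hnum : 3 * (f : ℂ) + 2 * Complex.I / (τ : ℂ) ≠ 0 := by
      convert ofReal_add_I_mul_ne_zero (mul_pos three_pos hf).ne' (2 / τ) using 1
      push_cast
      ring
    have hden : (f : ℂ) + Complex.I / (τ : ℂ) ≠ 0 := by
      convert ofReal_add_I_mul_ne_zero hf.ne' (1 / τ) using 1
      push_cast
      ring
    have hf0 : (f : ℂ) ≠ 0 := Complex.ofReal_ne_zero.mpr hf.ne'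
    rw [hQ]
    exact mul_ne_zero (Complex.ofReal_ne_zero.mpr (by positivity))
      (div_ne_zero hnum (mul_ne_zero (mul_ne_zero (by norm_num) hf0) (pow_ne_zero 2 hden)))
  have hB : 0 < ‖(k₀ : ℂ) * σn * (X₀ : ℂ)‖ := by
    rw [norm_pos_iff, hσn]
    exact mul_ne_zero (mul_ne_zero (Complex.ofReal_ne_zero.mpr hk₀.ne') (mul_ne_zero hσl0 hQ0))
      (Complex.ofReal_ne_zero.mpr hX₀)
  have hβ : 2 * π / d ≠ 0 := by positivity
  obtain ⟨c, hc, N, hN⟩ := exists_mul_one_add_sq_le hB hβ α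
    (|ku| + |kw| + ‖(k₀ : ℂ) * σl * (X₀ : ℂ)‖)
  have hgrowth : ∀ p : ℤ, (N : ℤ) ≤ |p| →
      c * (1 + |(p : ℝ)| ^ 2) ≤ ‖DeltaTE d α ku kw k₀ X₀ σl σn p‖ :=
    fun p hp => (hN p hp).trans (le_norm_DeltaTE d α ku kw k₀ X₀ σl σn p)
  refine ⟨⟨c, hc, N, hgrowth⟩, ?_⟩
  rintro ⟨μ, hμ, hμΔ⟩
  exact exists_one_div_le_div_one_add_sq hc hμ hgrowth hμΔ
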